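/- Weighted interpolation inequality: there exists a constant C > 0, depending only on C₁ and C₂, such that for every g ∈ C¹(Ω̄), ∫_Ω g² dx ≤ C (∫_Ω ρ₀ g² dx)^{1/2} (∫_Ω ρ₀ (g² + |Dg|²) dx)^{1/2}, i.e. ‖g‖_{L²(Ω)} ≤ C ‖g‖_{L²_{ρ₀}(Ω)}^{1/2} ‖g‖_{H¹_{ρ₀}(Ω)}^{1/2}. -/

import Mathlib

open MeasureTheory Real Filter

noncomputable section

/-- The reference domain `Ω = 𝕋 × (0,1)`, realized as the fundamental square `(0,1) × (0,1)`. -/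
def Oset : Set (ℝ × ℝ) := Set.Ioo (0:ℝ) 1 ×ˢ Set.Ioo (0:ℝ) 1

/-- The vacuum boundary `Γ = 𝕋 × {0,1}`. -/
def Gset : Set (ℝ × ℝ) := {x : ℝ × ℝ | x.2 = 0 ∨ x.2 = 1}

/-- Distance to the boundary `Γ`. -/
def distG (x : ℝ × ℝ) : ℝ := min x.2 (1 - x.2)

variable {F : Type*} [NormedAddCommGroup F] [NormedSpace ℝ F]

/-- Horizontal partial derivative `∂₁`. -/
def pd1 (f : ℝ × ℝ → F) : ℝ × ℝ → F := fun x => fderiv ℝ f x (1, 0)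

/-- Vertical (normal) partial derivative `∂₂`. -/
def pd2 (f : ℝ × ℝ → F) : ℝ × ℝ → F := fun x => fderiv ℝ f x (0, 1)

/-- Time derivative `∂ₜ`. -/
def pdt (v : ℝ → ℝ × ℝ → F) : ℝ → ℝ × ℝ → F := fun t x => deriv (fun s => v s x) t

/-- `|Df|²` at a point. -/
def gradSq (f : ℝ × ℝ → F) (x : ℝ × ℝ) : ℝ := ‖pd1 f x‖ ^ 2 + ‖pd2 f x‖ ^ 2

/-- 1-periodicity in the horizontal variable (functions on the torus `𝕋 × (0,1)`). -/
def Per (f : ℝ × ℝ → F) : Prop := ∀ x : ℝ × ℝ, f (x.1 + 1, x.2) = f x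

/-- Smoothness. -/
def SmoothFn (f : ℝ × ℝ → F) : Prop := ∀ n : ℕ, ContDiff ℝ n f

/-- Joint smoothness of a time dependent family. -/
def SmoothT (v : ℝ → ℝ × ℝ → F) : Prop :=
  ∀ n : ℕ, ContDiff ℝ n (fun p : ℝ × (ℝ × ℝ) => v p.1 p.2)

def PerT (v : ℝ → ℝ × ℝ → F) : Prop := ∀ t : ℝ, Per (v t)

/-- Admissible initial depth profile: smooth, periodic, vanishing on `Γ` and
comparable to the distance to the boundary. -/
def IsDensity (C₁ C₂ : ℝ) (ρ₀ : ℝ × ℝ → ℝ) : Prop :=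
  SmoothFn ρ₀ ∧ Per ρ₀ ∧ (∀ x ∈ Gset, ρ₀ x = 0) ∧
    ∀ x ∈ Oset, C₁ * distG x ≤ ρ₀ x ∧ ρ₀ x ≤ C₂ * distG x

/-- The higher-order energy functional `E(t,v)`. -/
def energy (ρ₀ : ℝ × ℝ → ℝ) (v : ℝ → ℝ × ℝ → ℝ × ℝ) (t : ℝ) : ℝ :=
  (∑ l₀ ∈ Finset.range 5, ∫ x in Oset, ρ₀ x * ‖(pdt^[l₀] v) t x‖ ^ 2)
    + (∑ l₀ ∈ Finset.range 4, ∑ l₁ ∈ Finset.range (7 - 2 * l₀),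
        ∫ x in Oset, ρ₀ x *
          (gradSq (pd1^[l₁] ((pdt^[l₀] v) t)) x + gradSq (pd1^[l₁ + 1] ((pdt^[l₀] v) t)) x))
    + ∑ l₀ ∈ Finset.range 4, ∑ l₁ ∈ Finset.range (7 - 2 * l₀),
        ∑ l₂ ∈ Finset.Icc 2 (8 - 2 * l₀ - l₁),
          ∫ x in Oset, ρ₀ x ^ l₂ * ‖(pd1^[l₁] (pd2^[l₂] ((pdt^[l₀] v) t))) x‖ ^ 2

/-- The Lagrangian flow map `η(x,t) = x + ∫₀ᵗ v(x,s) ds`. -/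
def flowMap (v : ℝ → ℝ × ℝ → ℝ × ℝ) (t : ℝ) (x : ℝ × ℝ) : ℝ × ℝ :=
  x + ∫ s in (0:ℝ)..t, v s x

/-- The (squared-sum) Sobolev `H^k(Ω)` norm. -/
def sobolevNorm (k : ℕ) (f : ℝ × ℝ → F) : ℝ :=
  Real.sqrt (∑ θ ∈ Finset.range (k + 1), ∫ x in Oset, ‖iteratedFDeriv ℝ θ f x‖ ^ 2)

/-- `sup_{0 ≤ s ≤ t} E(s,v)^{1/2}`. -/
def supEn (ρ₀ : ℝ × ℝ → ℝ) (v : ℝ → ℝ × ℝ → ℝ × ℝ) (t : ℝ) : ℝ :=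
  ⨆ s : Set.Icc (0:ℝ) t, Real.sqrt (energy ρ₀ v ↑s)

/-- Weighted `L²(Ω)` norm `‖ρ₀^p ∂₁^{l₁} D^k f‖_{L²(Ω)}`. -/
def wL2 (ρ₀ : ℝ × ℝ → ℝ) (p k l₁ : ℕ) (f : ℝ × ℝ → F) : ℝ :=
  Real.sqrt (∫ x in Oset, (ρ₀ x ^ p * ‖iteratedFDeriv ℝ k (pd1^[l₁] f) x‖) ^ 2)

/-- Weighted `L^∞(Ω)` norm `‖ρ₀^p ∂₁^{l₁} D^k f‖_{L^∞(Ω)}`. -/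
def wSup (ρ₀ : ℝ × ℝ → ℝ) (p k l₁ : ℕ) (f : ℝ × ℝ → F) : ℝ :=
  ⨆ x : Oset, ρ₀ (x : ℝ × ℝ) ^ p * ‖iteratedFDeriv ℝ k (pd1^[l₁] f) (x : ℝ × ℝ)‖

def pick (i : Fin 2) (w : ℝ × ℝ) : ℝ := if i = 0 then w.1 else w.2

def evec (k : Fin 2) : ℝ × ℝ := if k = 0 then (1, 0) else (0, 1)

def pdk (k : Fin 2) (f : ℝ × ℝ → ℝ) : ℝ × ℝ → ℝ := fun x => fderiv ℝ f x (evec k)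

/-- The cofactor matrix `a` of `Dη`, `a = [[∂₂η², −∂₂η¹], [−∂₁η², ∂₁η¹]]`,
indexed so that `cof η x i k = a_i^k`. -/
def cof (η : ℝ × ℝ → ℝ × ℝ) (x : ℝ × ℝ) (i k : Fin 2) : ℝ :=
  if i = 0 then
    (if k = 0 then pd2 (fun y => (η y).2) x else -pd1 (fun y => (η y).2) x)
  else
    (if k = 0 then -pd2 (fun y => (η y).1) x else pd1 (fun y => (η y).1) x)

/-- The Jacobian determinant `J = det Dη`. -/
def jac (η : ℝ × ℝ → ℝ × ℝ) (x : ℝ × ℝ) : ℝ :=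
  pd1 (fun y => (η y).1) x * pd2 (fun y => (η y).2) x
    - pd2 (fun y => (η y).1) x * pd1 (fun y => (η y).2) x

/-- `b^{kj} = a_l^k a_l^j`. -/
def bmat (η : ℝ × ℝ → ℝ × ℝ) (x : ℝ × ℝ) (k j : Fin 2) : ℝ :=
  ∑ l : Fin 2, cof η x l k * cof η x l j

/-- `(v,η)` is a (classical) solution of the Lagrangian system
`ρ₀ ∂ₜ v^i + (ρ₀² J⁻² a_i^k),_k = (ρ₀ J⁻² b^{kj} v^i,_j),_k` in `Ω × (0,T]`. -/
def IsLagSol (ρ₀ : ℝ × ℝ → ℝ) (v : ℝ → ℝ × ℝ → ℝ × ℝ) (T : ℝ) : Prop :=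
  ∀ t : ℝ, 0 < t → t ≤ T → ∀ x ∈ Oset, ∀ i : Fin 2,
    ρ₀ x * pick i (pdt v t x)
        + ∑ k : Fin 2, pdk k
            (fun y => ρ₀ y ^ 2 * jac (flowMap v t) y ^ (-2 : ℤ) * cof (flowMap v t) y i k) x
      = ∑ k : Fin 2, pdk k
          (fun y => ρ₀ y * jac (flowMap v t) y ^ (-2 : ℤ) *
            ∑ j : Fin 2, bmat (flowMap v t) y k j * pdk j (fun z => pick i (v t z)) y) x

/-- The a priori assumption: `sup_{0≤t≤T} E(t,v) ≤ M₁`,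
`T ∈ (0, 1/(20c₁c₂√M₁ + 10c₁²c₂²M₁)] ∩ (0,1)`, where `c₁, c₂` are the constants of the
embedding inequalities, so that in particular `‖Dv‖_{L^∞} ≤ c₁c₂ E^{1/2}`. -/
def Apriori (ρ₀ : ℝ × ℝ → ℝ) (v : ℝ → ℝ × ℝ → ℝ × ℝ) (T M₁ c₁ c₂ : ℝ) : Prop :=
  0 < c₁ ∧ 0 < c₂ ∧ 0 ≤ M₁ ∧ 0 < T ∧ T ≤ 1 ∧
    T ≤ 1 / (20 * c₁ * c₂ * Real.sqrt M₁ + 10 * c₁ ^ 2 * c₂ ^ 2 * M₁) ∧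
    (∀ t ∈ Set.Icc (0:ℝ) T, energy ρ₀ v t ≤ M₁) ∧
    ∀ t ∈ Set.Icc (0:ℝ) T, ∀ x ∈ Oset,
      ‖fderiv ℝ (v t) x‖ ≤ c₁ * c₂ * Real.sqrt (energy ρ₀ v t)

/-- Smooth test functions compactly supported in `Ω`. -/
def CinfTest (φ : ℝ × ℝ → ℝ) : Prop :=
  (∀ n : ℕ, ContDiff ℝ n φ) ∧ HasCompactSupport φ ∧ tsupport φ ⊆ Oset

/-- `g` is the weak directional derivative of `u` in direction `e` on `Ω`. -/
def WeakPD (e : ℝ × ℝ) (u g : ℝ × ℝ → ℝ) : Prop :=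
  ∀ φ : ℝ × ℝ → ℝ, CinfTest φ →
    ∫ x in Oset, u x * fderiv ℝ φ x e = -∫ x in Oset, g x * φ x

/-- Membership in the weighted space `H¹_{ρ₀}(Ω)`, with weak gradient `Dw`. -/
def InH1w (ρ₀ : ℝ × ℝ → ℝ) (w : ℝ × ℝ → ℝ) (Dw : ℝ × ℝ → ℝ × ℝ) : Prop :=
  AEStronglyMeasurable w (volume.restrict Oset) ∧
    AEStronglyMeasurable Dw (volume.restrict Oset) ∧
    IntegrableOn (fun x => ρ₀ x * (w x) ^ 2) Oset ∧
    IntegrableOn (fun x => ρ₀ x * ‖Dw x‖ ^ 2) Oset ∧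
    WeakPD (1, 0) w (fun x => (Dw x).1) ∧ WeakPD (0, 1) w (fun x => (Dw x).2)

/-- The bilinear form `B[w,φ]_μ = ∫_Ω ρ₀ (Dw·Dφ + wφ) dx`. -/
def Bform (ρ₀ : ℝ × ℝ → ℝ) (w : ℝ × ℝ → ℝ) (Dw : ℝ × ℝ → ℝ × ℝ)
    (φ : ℝ × ℝ → ℝ) (Dφ : ℝ × ℝ → ℝ × ℝ) : ℝ :=
  ∫ x in Oset, ρ₀ x * ((Dw x).1 * (Dφ x).1 + (Dw x).2 * (Dφ x).2 + w x * φ x)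

/-- Continuous functions are integrable on the bounded set `Oset`. -/
lemma oset_integrable {f : ℝ × ℝ → ℝ} (hf : Continuous f) : IntegrableOn f Oset := by
  have hK : IsCompact (Set.Icc (0:ℝ) 1 ×ˢ Set.Icc (0:ℝ) 1) := isCompact_Icc.prod isCompact_Icc
  exact (hf.continuousOn.integrableOn_compact hK).mono_set
    (Set.prod_mono Set.Ioo_subset_Icc_self Set.Ioo_subset_Icc_self)

lemma oset_meas : MeasurableSet Oset := measurableSet_Ioo.prod measurableSet_Ioo

/-- The cubic multiplier vanishing at `0`, `1/2`, `1`. -/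
def cubicPhi (y : ℝ) : ℝ := y * (1 - y) * (y - 1 / 2)

/-- The integrated vertical derivative of `cubicPhi * g ^ 2` vanishes. -/
lemma oset_div_zero (g : ℝ × ℝ → ℝ) (hg : ContDiff ℝ 1 g) :
    ∫ x in Oset, ((3 * (x.2 * (1 - x.2)) - 1 / 2) * g x ^ 2
      + cubicPhi x.2 * (2 * g x * pd2 g x)) = 0 := by
  have hc : Continuous (fderiv ℝ g) := hg.continuous_fderiv one_ne_zero
  have hp : Continuous (pd2 g) := hc.clm_apply continuous_const
  have hgc := hg.continuous
  have hcont : Continuous (fun x : ℝ × ℝ => (3 * (x.2 * (1 - x.2)) - 1 / 2) * g x ^ 2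
      + cubicPhi x.2 * (2 * g x * pd2 g x)) := by
    unfold cubicPhi; fun_prop
  have hint := oset_integrable hcont
  unfold Oset at hint ⊢
  rw [Measure.volume_eq_prod] at hint ⊢
  rw [setIntegral_prod _ hint]
  have key : ∀ a : ℝ, ∫ y in Set.Ioo (0:ℝ) 1, ((3 * (y * (1 - y)) - 1 / 2) * g (a, y) ^ 2
      + cubicPhi y * (2 * g (a, y) * pd2 g (a, y))) = 0 := by
    intro a
    rw [← integral_Ioc_eq_integral_Ioo, ← intervalIntegral.integral_of_le zero_le_one]
    rw [intervalIntegral.integral_eq_sub_of_hasDerivAt (f := fun y => cubicPhi y * g (a, y) ^ 2)]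
    · simp [cubicPhi]
    · intro y _
      have h1 : HasDerivAt (fun y : ℝ => (a, y)) ((0:ℝ), (1:ℝ)) y :=
        (hasDerivAt_const y a).prodMk (hasDerivAt_id y)
      have h2 : HasDerivAt (fun y => g (a, y)) (pd2 g (a, y)) y :=
        ((hg.differentiable one_ne_zero (a, y)).hasFDerivAt).comp_hasDerivAt y h1
      have h3 : HasDerivAt cubicPhi (3 * (y * (1 - y)) - 1 / 2) y := by
        have := ((hasDerivAt_id y).mul ((hasDerivAt_id y).const_sub 1)).mul
          ((hasDerivAt_id y).sub_const (1 / 2))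
        refine HasDerivAt.congr_deriv this ?_
        simp; ring
      refine (h3.mul (h2.pow 2)).congr_deriv ?_
      simp
    · apply Continuous.intervalIntegrable
      exact hcont.comp (by fun_prop : Continuous fun y : ℝ => (a, y))
  simp only [key, integral_zero]

/-- Weighted Cauchy-Schwarz on `Oset`. -/
lemma oset_cs (r u s : ℝ × ℝ → ℝ) (hr : Continuous r) (hu : Continuous u) (hs : Continuous s)
    (h0 : ∀ x ∈ Oset, 0 ≤ r x) :
    ∫ x in Oset, r x * (u x * s x)
      ≤ √(∫ x in Oset, r x * u x ^ 2) * √(∫ x in Oset, r x * s x ^ 2) := by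
  set A := ∫ x in Oset, r x * u x ^ 2 with hA
  set B := ∫ x in Oset, r x * s x ^ 2
  set X := ∫ x in Oset, r x * (u x * s x)
  have iA : IntegrableOn (fun x => r x * u x ^ 2) Oset := oset_integrable (by fun_prop)
  have iB : IntegrableOn (fun x => r x * s x ^ 2) Oset := oset_integrable (by fun_prop)
  have iX : IntegrableOn (fun x => r x * (u x * s x)) Oset := oset_integrable (by fun_prop)
  have hA0 : 0 ≤ A := setIntegral_nonneg oset_meas fun x hx => mul_nonneg (h0 x hx) (sq_nonneg _)
  have hq : ∀ t : ℝ, 0 ≤ A * (t * t) + (2 * X) * t + B := by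
    intro t
    have h : 0 ≤ ∫ x in Oset, r x * (t * u x + s x) ^ 2 :=
      setIntegral_nonneg oset_meas fun x hx => mul_nonneg (h0 x hx) (sq_nonneg _)
    have e : ∫ x in Oset, r x * (t * u x + s x) ^ 2
        = ∫ x in Oset, ((t * t) * (r x * u x ^ 2) + (2 * t) * (r x * (u x * s x))
          + r x * s x ^ 2) := by
      congr 1; ext x; ring
    have iS : IntegrableOn (fun x => (t * t) * (r x * u x ^ 2) + (2 * t) * (r x * (u x * s x)))
        Oset := (iA.const_mul _).add (iX.const_mul _)
    rw [e, integral_add iS iB,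
      integral_add (iA.const_mul _) (iX.const_mul _), integral_const_mul, integral_const_mul] at h
    linarith
  have hd := discrim_le_zero hq
  unfold discrim at hd
  rw [← Real.sqrt_mul hA0]
  exact Real.le_sqrt_of_sq_le (by nlinarith)

/-- (Weighted interpolation inequality, Lemma 3.10.)
`‖g‖_{L²(Ω)} ≤ C ‖g‖_{L²_{ρ₀}(Ω)}^{1/2} ‖g‖_{H¹_{ρ₀}(Ω)}^{1/2}`, i.e.
`∫_Ω g² ≤ C (∫_Ω ρ₀ g²)^{1/2} (∫_Ω ρ₀(g² + |Dg|²))^{1/2}` for every `g ∈ C¹(Ω̄)`. -/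
theorem stmt7 (C₁ C₂ : ℝ) (hC₁ : 0 < C₁) (hC₁₂ : C₁ ≤ C₂) :
    ∃ C > (0:ℝ),
      ∀ ρ₀ : ℝ × ℝ → ℝ, IsDensity C₁ C₂ ρ₀ →
        ∀ g : ℝ × ℝ → ℝ, ContDiff ℝ 1 g → Per g →
          (∫ x in Oset, (g x) ^ 2)
            ≤ C * Real.sqrt (∫ x in Oset, ρ₀ x * (g x) ^ 2) *
                Real.sqrt (∫ x in Oset, ρ₀ x * ((g x) ^ 2 + ‖fderiv ℝ g x‖ ^ 2)) := by
  refine ⟨8 / C₁, by positivity, ?_⟩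
  rintro ρ ⟨hsm, -, -, hρ⟩ g hg -
  have hρc : Continuous ρ := (hsm 0).continuous
  have hgc := hg.continuous
  have hc : Continuous (fderiv ℝ g) := hg.continuous_fderiv one_ne_zero
  have hp : Continuous (pd2 g) := hc.clm_apply continuous_const
  have hw : ∀ x ∈ Oset, 0 ≤ x.2 * (1 - x.2) ∧ C₁ * (x.2 * (1 - x.2)) ≤ ρ x := by
    intro x hx
    obtain ⟨h1, h2⟩ := hx.2
    have h3 : x.2 * (1 - x.2) ≤ distG x := le_min (by nlinarith) (by nlinarith)
    exact ⟨mul_nonneg h1.le (by linarith),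
      (mul_le_mul_of_nonneg_left h3 hC₁.le).trans (hρ x hx).1⟩
  have hρ0 : ∀ x ∈ Oset, 0 ≤ ρ x := fun x hx =>
    (mul_nonneg hC₁.le (hw x hx).1).trans (hw x hx).2
  let s : ℝ × ℝ → ℝ := fun x => √(g x ^ 2 + ‖fderiv ℝ g x‖ ^ 2)
  have hs : Continuous s := by fun_prop
  have hcs := oset_cs ρ (fun x => |g x|) s hρc hgc.abs hs hρ0
  have hs2 : ∀ x, s x ^ 2 = g x ^ 2 + ‖fderiv ℝ g x‖ ^ 2 := fun x => Real.sq_sqrt (by positivity)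
  simp only [hs2, sq_abs] at hcs
  have hdiv := oset_div_zero g hg
  have i1 : IntegrableOn (fun x => g x ^ 2) Oset := oset_integrable (by fun_prop)
  have i2 : IntegrableOn (fun x => (3 * (x.2 * (1 - x.2)) - 1 / 2) * g x ^ 2
      + cubicPhi x.2 * (2 * g x * pd2 g x)) Oset :=
    oset_integrable (by unfold cubicPhi; fun_prop)
  have i3 : IntegrableOn (fun x => 8 / C₁ * (ρ x * (|g x| * s x))) Oset :=
    oset_integrable (by fun_prop)
  have hmono : ∫ x in Oset, (g x ^ 2 + 2 * ((3 * (x.2 * (1 - x.2)) - 1 / 2) * g x ^ 2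
      + cubicPhi x.2 * (2 * g x * pd2 g x))) ≤ ∫ x in Oset, 8 / C₁ * (ρ x * (|g x| * s x)) := by
    refine setIntegral_mono_on (i1.add (i2.const_mul 2)) i3 oset_meas ?_
    intro x hx
    obtain ⟨hw0, hw1⟩ := hw x hx
    obtain ⟨h1, h2⟩ := hx.2
    have hgs : |g x| ≤ s x := Real.abs_le_sqrt (by nlinarith [sq_nonneg ‖fderiv ℝ g x‖])
    have hps : |pd2 g x| ≤ s x := by
      have ha : |pd2 g x| ≤ ‖fderiv ℝ g x‖ := by
        have := (fderiv ℝ g x).le_opNorm ((0:ℝ), (1:ℝ))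
        simpa [pd2, Prod.norm_def] using this
      exact ha.trans (Real.le_sqrt_of_sq_le (by nlinarith [sq_nonneg (g x)]))
    have hy : |x.2 - 1 / 2| ≤ 1 / 2 := abs_le.2 ⟨by linarith, by linarith⟩
    have hb : (x.2 - 1 / 2) * (g x * pd2 g x) ≤ 1 / 2 * (|g x| * s x) := by
      refine (le_abs_self _).trans ?_
      rw [abs_mul, abs_mul]
      gcongr
    have hgg : g x ^ 2 ≤ |g x| * s x := by
      rw [← sq_abs, sq]
      gcongr
    have hn : 0 ≤ |g x| * s x := (sq_nonneg _).trans hgg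
    calc g x ^ 2 + 2 * ((3 * (x.2 * (1 - x.2)) - 1 / 2) * g x ^ 2
          + cubicPhi x.2 * (2 * g x * pd2 g x))
        = (x.2 * (1 - x.2)) * (6 * g x ^ 2 + 4 * ((x.2 - 1 / 2) * (g x * pd2 g x))) := by
          unfold cubicPhi; ring
      _ ≤ (x.2 * (1 - x.2)) * (8 * (|g x| * s x)) :=
          mul_le_mul_of_nonneg_left (by linarith) hw0
      _ = 8 / C₁ * ((C₁ * (x.2 * (1 - x.2))) * (|g x| * s x)) := by field_simp
      _ ≤ 8 / C₁ * (ρ x * (|g x| * s x)) := by gcongr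
  rw [integral_add i1 (i2.const_mul 2), integral_const_mul, hdiv, integral_const_mul] at hmono
  have := mul_le_mul_of_nonneg_left hcs (by positivity : 0 ≤ 8 / C₁)
  rw [mul_assoc]
  linarith
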